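/- There exists an absolute constant C > 0 such that for every ε ∈ (0, 1] the following holds. Let L be a tame path and let S ⊂ L be a finite set of points. Then there exists a geometric graph E comprised of the edges of L together with additional segments of total weight at most C · ε^{−1/2} · hper(L), such that for all a, b ∈ S, if the segment ab lies below L (i.e. ab ⊆ R(L)) and |x(a) − x(b)| ≤ ε^{1/2}·|y(a) − y(b)| (i.e. the slope of ab is at least ε^{−1/2} in absolute value, or ab is vertical), then there is an ab-path P in E with weight ‖P‖ ≤ (1 + C·ε)·‖a − b‖. -/

import Mathlib

open scoped Classical

noncomputable section

/-- The Euclidean plane. -/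
abbrev Plane : Type := EuclideanSpace ℝ (Fin 2)

/-- The point `(x, y) ∈ ℝ²`. -/
def pt (x y : ℝ) : Plane := (EuclideanSpace.equiv (Fin 2) ℝ).symm ![x, y]

/-- The union of the segments of a geometric graph. -/
def segUnion (E : Finset (Plane × Plane)) : Set Plane :=
  ⋃ e ∈ E, segment ℝ e.1 e.2

/-- The total weight of a geometric graph: the sum of the Euclidean lengths of its
segments. -/
def gweight (E : Finset (Plane × Plane)) : ℝ :=
  ∑ e ∈ E, ‖e.1 - e.2‖

/-- `HasPath E s t w` : there is a polygonal path from `s` to `t`, each of whose edges is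
contained in the union of the segments of `E`, of weight at most `w`. -/
def HasPath (E : Finset (Plane × Plane)) (s t : Plane) (w : ℝ) : Prop :=
  ∃ (m : ℕ) (v : ℕ → Plane), v 0 = s ∧ v m = t ∧
    (∀ i < m, segment ℝ (v i) (v (i + 1)) ⊆ segUnion E) ∧
    ∑ i ∈ Finset.range m, ‖v (i + 1) - v i‖ ≤ w

/-- A rectilinear path: every edge is horizontal or vertical. -/
def IsRectilinear (n : ℕ) (u : ℕ → Plane) : Prop :=
  ∀ i < n, u i 0 = u (i + 1) 0 ∨ u i 1 = u (i + 1) 1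

/-- The set of points of the polygonal path with vertices `u 0, …, u n`. -/
def pathSet (n : ℕ) (u : ℕ → Plane) : Set Plane :=
  ⋃ i ∈ Finset.range n, segment ℝ (u i) (u (i + 1))

/-- The edges of the polygonal path with vertices `u 0, …, u n`, as a geometric graph. -/
def pathEdges (n : ℕ) (u : ℕ → Plane) : Finset (Plane × Plane) :=
  (Finset.range n).image fun i => (u i, u (i + 1))

/-- The region below an `x`-monotone path with point set `L` : points `p` that lie
vertically below some point of `L` and not below the lowest point of `L`. -/
def belowRegion (L : Set Plane) : Set Plane :=
  {p | (∃ q ∈ L, q 0 = p 0 ∧ p 1 ≤ q 1) ∧ (∃ q ∈ L, q 1 ≤ p 1)}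

/-- The length of the subpath of the path `u 0, …, u n` from a point `a` on the `i`-th
edge to a point `b` on the `j`-th edge (for `i ≤ j`). -/
def subLen (u : ℕ → Plane) (i j : ℕ) (a b : Plane) : ℝ :=
  if i = j then ‖b - a‖
  else ‖u (i + 1) - a‖ + (∑ k ∈ Finset.Ico (i + 1) j, ‖u (k + 1) - u k‖) + ‖b - u j‖

/-- The point set of the subpath of the path `u 0, …, u n` from a point `a` on the `i`-th
edge to a point `b` on the `j`-th edge (for `i ≤ j`). -/
def subSet (u : ℕ → Plane) (i j : ℕ) (a b : Plane) : Set Plane :=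
  if i = j then segment ℝ a b
  else segment ℝ a (u (i + 1)) ∪
    (⋃ k ∈ Finset.Ico (i + 1) j, segment ℝ (u k) (u (k + 1))) ∪ segment ℝ (u j) b

/-- A tame path: an `x`-monotone (nondecreasing) rectilinear path such that for every
horizontal chord `ab` (with `a`, `b` on the path and the segment `ab` contained in the
region below the path), the subpath between `a` and `b` has length at most `2·‖a − b‖`. -/
def IsTamePath (n : ℕ) (u : ℕ → Plane) : Prop :=
  IsRectilinear n u ∧ (∀ i < n, u i 0 ≤ u (i + 1) 0) ∧
  ∀ (i j : ℕ) (a b : Plane), i ≤ j → j < n →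
    a ∈ segment ℝ (u i) (u (i + 1)) → b ∈ segment ℝ (u j) (u (j + 1)) →
    a 1 = b 1 → segment ℝ a b ⊆ belowRegion (pathSet n u) →
    subLen u i j a b ≤ 2 * ‖a - b‖

/-- The total length of the horizontal edges of a rectilinear path. -/
def hper (n : ℕ) (u : ℕ → Plane) : ℝ :=
  ∑ i ∈ Finset.range n, |u (i + 1) 0 - u i 0|

/-- `Conn U s t w`: there is a polygonal path inside `U` from `s` to `t` of length at most `w`. -/
inductive Conn (U : Set Plane) : Plane → Plane → ℝ → Prop
  | refl (a : Plane) {w : ℝ} (hw : 0 ≤ w) : Conn U a a w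
  | step {a b c : Plane} {w w' : ℝ} (hab : segment ℝ a b ⊆ U) (h : Conn U b c w)
      (hw : ‖b - a‖ + w ≤ w') : Conn U a c w'

namespace Conn

variable {U V : Set Plane} {a b c : Plane} {w w' : ℝ}

theorem mono (h : Conn U a b w) (hUV : U ⊆ V) (hw : w ≤ w') : Conn V a b w' := by
  induction h generalizing w' with
  | refl a h0 => exact .refl a (h0.trans hw)
  | step hab _ hle ih => exact .step (hab.trans hUV) (ih le_rfl) (hle.trans hw)

theorem trans (h : Conn U a b w) (h' : Conn U b c w') : Conn U a c (w + w') := by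
  induction h with
  | refl a h0 => exact h'.mono subset_rfl (by linarith)
  | step hab _ hle ih => exact .step hab (ih h') (by linarith)

theorem of_segment (h : segment ℝ a b ⊆ U) (hw : ‖b - a‖ ≤ w) : Conn U a b w :=
  .step h (.refl b le_rfl) (by linarith)

theorem symm (h : Conn U a b w) : Conn U b a w := by
  induction h with
  | refl a h0 => exact .refl a h0
  | @step a b c w w' hab _ hle ih =>
    refine (ih.trans (of_segment (w := ‖b - a‖) ?_ ?_)).mono subset_rfl (by linarith)
    · rwa [segment_symm]
    · rw [norm_sub_rev]

theorem hasPath {E : Finset (Plane × Plane)} (h : Conn (segUnion E) a b w) :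
    HasPath E a b w := by
  induction h with
  | refl a h0 => exact ⟨0, fun _ => a, rfl, rfl, by simp, by simpa using h0⟩
  | @step a b c w w' hab _ hle ih =>
    obtain ⟨m, v, h0, hm, hs, hl⟩ := ih
    refine ⟨m + 1, fun i => Nat.casesOn i a v, rfl, hm, ?_, ?_⟩
    · rintro (_ | i) hi
      · simpa [h0] using hab
      · exact hs i (by omega)
    · rw [Finset.sum_range_succ']
      change (∑ i ∈ Finset.range m, ‖v (i + 1) - v i‖) + ‖v 0 - a‖ ≤ w'
      rw [h0]
      linarith

end Conn

theorem segUnion_union (E F : Finset (Plane × Plane)) :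
    segUnion (E ∪ F) = segUnion E ∪ segUnion F := by
  simp only [segUnion, Finset.mem_union]
  exact Set.biUnion_union (E : Set (Plane × Plane)) F fun e => segment ℝ e.1 e.2

theorem gweight_union_le (E F : Finset (Plane × Plane)) :
    gweight (E ∪ F) ≤ gweight E + gweight F := by
  have h := Finset.sum_union_inter (s₁ := E) (s₂ := F) (f := fun e => ‖e.1 - e.2‖)
  have h0 : 0 ≤ ∑ e ∈ E ∩ F, ‖e.1 - e.2‖ := Finset.sum_nonneg fun _ _ => norm_nonneg _
  simp only [gweight]
  linarith

theorem Plane.norm_le_abs_add_abs (p : Plane) : ‖p‖ ≤ |p 0| + |p 1| := by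
  rw [EuclideanSpace.norm_eq, Fin.sum_univ_two]
  apply Real.sqrt_le_iff.2
  refine ⟨by positivity, ?_⟩
  simp only [Real.norm_eq_abs]
  nlinarith [abs_nonneg (p 0), abs_nonneg (p 1)]

theorem Plane.norm_le_of_sq_le {p : Plane} {r : ℝ} (hr : 0 ≤ r) (h : p 0 ^ 2 + p 1 ^ 2 ≤ r ^ 2) :
    ‖p‖ ≤ r := by
  rw [EuclideanSpace.norm_eq, Fin.sum_univ_two]
  apply Real.sqrt_le_iff.2
  simpa [Real.norm_eq_abs] using ⟨hr, h⟩

theorem Plane.abs_snd_le_norm (p : Plane) : |p 1| ≤ ‖p‖ := by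
  simpa using PiLp.norm_apply_le p 1

theorem Plane.ext' {p q : Plane} (h0 : p 0 = q 0) (h1 : p 1 = q 1) : p = q := by
  ext i; fin_cases i <;> assumption

/-- A point with the same abscissa as two others and with ordinate between theirs lies on the
segment they span. -/
theorem mem_segment_of_vertical {p q z : Plane} (h0 : p 0 = q 0) (hz : z 0 = p 0)
    (h1 : p 1 ≤ z 1) (h2 : z 1 ≤ q 1) : z ∈ segment ℝ p q := by
  have hseg : z 1 ∈ segment ℝ (p 1) (q 1) := by
    rw [segment_eq_Icc (h1.trans h2)]; exact ⟨h1, h2⟩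
  obtain ⟨s, t, hs, ht, hst, h⟩ := hseg
  refine ⟨s, t, hs, ht, hst, Plane.ext' ?_ ?_⟩
  · simp only [PiLp.add_apply, PiLp.smul_apply, smul_eq_mul, ← h0, hz]
    rw [← add_mul, hst, one_mul]
  · simpa using h

/-- The step conditions for a path `P` with vertices `P 0, …, P N`, whose progress is measured by
`X`: every edge either goes straight up without progress, or its extent in both coordinates is
bounded by the progress made along it. -/
def Climbing (N : ℕ) (P : ℕ → Plane) (X : ℕ → ℝ) : Prop :=
  ∀ i < N, X i ≤ X (i + 1) ∧ |P (i + 1) 0 - P i 0| ≤ X (i + 1) - X i ∧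
    X i - X (i + 1) ≤ P (i + 1) 1 - P i 1 ∧
    (P (i + 1) 1 - P i 1 ≤ X (i + 1) - X i ∨ X (i + 1) = X i)

/-- The vertices `P b, …, P a` stay above the ray of slope `σ` (with respect to `X`)
starting at `P b`. -/
def Above (P : ℕ → Plane) (X : ℕ → ℝ) (σ : ℝ) (b a : ℕ) : Prop :=
  ∀ k, b ≤ k → k ≤ a → P b 1 + σ * (X k - X b) ≤ P k 1

theorem above_shift_iff {P : ℕ → Plane} {X : ℕ → ℝ} {σ : ℝ} {l b a : ℕ} :
    Above (fun i => P (l + i)) (fun i => X (l + i)) σ b a ↔ Above P X σ (l + b) (l + a) := by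
  refine ⟨fun h k hk hka => ?_, fun h k hk hka => h (l + k) (by omega) (by omega)⟩
  obtain ⟨k, rfl⟩ := Nat.exists_eq_add_of_le (show l ≤ k by omega)
  exact h k (by omega) (by omega)

namespace Climbing

variable {N : ℕ} {P : ℕ → Plane} {X : ℕ → ℝ}

theorem restrict (h : Climbing N P X) {M : ℕ} (hM : M ≤ N) : Climbing M P X :=
  fun i hi => h i (by omega)

theorem shift (h : Climbing N P X) {l M : ℕ} (hM : l + M ≤ N) :
    Climbing M (fun i => P (l + i)) (fun i => X (l + i)) :=
  fun i hi => h (l + i) (by omega)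

theorem mono (h : Climbing N P X) {i j : ℕ} (hij : i ≤ j) (hj : j ≤ N) : X i ≤ X j := by
  induction j, hij using Nat.le_induction with
  | base => rfl
  | succ k _ ih => exact (ih (by omega)).trans (h k (by omega)).1

theorem abs_fst_sub_le (h : Climbing N P X) {i j : ℕ} (hij : i ≤ j) (hj : j ≤ N) :
    |P j 0 - P i 0| ≤ X j - X i := by
  induction j, hij using Nat.le_induction with
  | base => simp
  | succ k _ ih =>
    have h1 := ih (by omega)
    have h2 := (h k (by omega)).2.1
    have h3 := abs_add_le (P (k + 1) 0 - P k 0) (P k 0 - P i 0)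
    rw [sub_add_sub_cancel] at h3
    linarith

theorem le_snd_sub (h : Climbing N P X) {i j : ℕ} (hij : i ≤ j) (hj : j ≤ N) :
    X i - X j ≤ P j 1 - P i 1 := by
  induction j, hij using Nat.le_induction with
  | base => simp
  | succ k _ ih =>
    have h1 := ih (by omega)
    have h2 := (h k (by omega)).2.2.1
    linarith

/-- Following the path itself costs at most its net climb plus three times its progress. -/
theorem conn (h : Climbing N P X) {U : Set Plane}
    (hU : ∀ i < N, segment ℝ (P i) (P (i + 1)) ⊆ U) {i j : ℕ} (hij : i ≤ j) (hj : j ≤ N) :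
    Conn U (P i) (P j) (P j 1 - P i 1 + 3 * (X j - X i)) := by
  induction j, hij using Nat.le_induction with
  | base => exact .refl _ (by simp)
  | succ k _ ih =>
    have hk : k < N := by omega
    obtain ⟨h0, h1, h2, h3⟩ := h k hk
    refine ((ih hk.le).trans (Conn.of_segment (hU k hk)
      (w := P (k + 1) 1 - P k 1 + 3 * (X (k + 1) - X k)) ?_)).mono subset_rfl (by linarith)
    refine (Plane.norm_le_abs_add_abs _).trans ?_
    simp only [PiLp.sub_apply]
    have : |P (k + 1) 1 - P k 1| ≤ P (k + 1) 1 - P k 1 + 2 * (X (k + 1) - X k) :=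
      abs_le.2 ⟨by linarith, by linarith⟩
    linarith

end Climbing

/-- Every path with `N` edges staying above the ray of slope `σ` from its first vertex can be
augmented, at a cost proportional to `σ` times its progress, so that all the pairs of its vertices
in the relation `Above` are well connected. -/
def Augmentable (σ : ℝ) (N : ℕ) : Prop :=
  ∀ (P : ℕ → Plane) (X : ℕ → ℝ) (U : Set Plane), Climbing N P X →
    (∀ i < N, segment ℝ (P i) (P (i + 1)) ⊆ U) → Above P X σ 0 N →
    ∃ Ex : Finset (Plane × Plane), gweight Ex ≤ 272 * (σ * (X N - X 0)) ∧
      ∀ b a, b ≤ a → a ≤ N → Above P X σ b a →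
        Conn (U ∪ segUnion Ex) (P b) (P a) (P a 1 - P b 1 + 272 * (σ⁻¹ * (X a - X b)))

/-- Partition of an arbitrary climbing path into maximal pieces staying above the ray of slope `σ`
from their first vertices. The potential `φ` controls the total progress on these pieces. -/
theorem exists_augment_pieces {σ : ℝ} {M : ℕ} (hA : ∀ N ≤ M, Augmentable σ N) :
    ∀ N ≤ M, ∀ (P : ℕ → Plane) (X φ : ℕ → ℝ) (U : Set Plane), Climbing N P X →
    (∀ i < N, segment ℝ (P i) (P (i + 1)) ⊆ U) →
    (∀ i < N, φ i ≤ φ (i + 1)) →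
    (∀ j r, j ≤ r → r ≤ N → Above P X σ j r → σ * (X r - X j) ≤ φ r - φ j) →
    ∃ Ex : Finset (Plane × Plane), gweight Ex ≤ 272 * (φ N - φ 0) ∧
      (∀ b a, b ≤ a → a ≤ N → Above P X σ b a →
        Conn (U ∪ segUnion Ex) (P b) (P a) (P a 1 - P b 1 + 272 * (σ⁻¹ * (X a - X b)))) ∧
      ∀ a ≤ N, ∃ j ≤ a, P j 1 ≤ P 0 1 + σ * (X j - X 0) ∧
        Conn (U ∪ segUnion Ex) (P j) (P a) (P a 1 - P j 1 + 272 * (σ⁻¹ * (X a - X j))) := by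
  intro N
  induction N using Nat.strong_induction_on with
  | _ N ih =>
  intro hN P X φ U hP hU hφ hrun
  by_cases hab : Above P X σ 0 N
  · obtain ⟨Ex, hw, hc⟩ := hA N hN P X U hP hU hab
    refine ⟨Ex, ?_, hc, fun a ha => ⟨0, by omega, by simp, hc 0 a (by omega) ha ?_⟩⟩
    · have := hrun 0 N (by omega) le_rfl hab
      linarith
    · exact fun k hk hka => hab k hk (by omega)
  have hex : ∃ p, p ≤ N ∧ P p 1 < P 0 1 + σ * (X p - X 0) := by
    by_contra! hcon
    exact hab fun k _ hk => hcon k hk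
  obtain ⟨p, ⟨hpN, hp⟩, hmin⟩ : ∃ p, (p ≤ N ∧ P p 1 < P 0 1 + σ * (X p - X 0)) ∧
      ∀ m < p, ¬(m ≤ N ∧ P m 1 < P 0 1 + σ * (X m - X 0)) :=
    ⟨Nat.find hex, Nat.find_spec hex, fun m hm => Nat.find_min hex hm⟩
  have hp0 : p ≠ 0 := by
    intro h0
    rw [h0] at hp
    simp at hp
  obtain ⟨r, rfl⟩ : ∃ r, p = r + 1 := ⟨p - 1, by omega⟩
  have habr : Above P X σ 0 r := by
    intro k _ hk
    by_contra! hlt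
    exact hmin k (by omega) ⟨by omega, hlt⟩
  obtain ⟨E₁, hw₁, hc₁⟩ := hA r (by omega) P X U (hP.restrict (by omega))
    (fun i hi => hU i (by omega)) habr
  obtain ⟨E₂, hw₂, hc₂, hl₂⟩ := ih (N - (r + 1)) (by omega) (by omega)
    (fun i => P (r + 1 + i)) (fun i => X (r + 1 + i)) (fun i => φ (r + 1 + i)) U
    (hP.shift (by omega)) (fun i hi => hU (r + 1 + i) (by omega))
    (fun i hi => hφ (r + 1 + i) (by omega))
    (fun j s hjs hs h => hrun _ _ (by omega) (by omega) (above_shift_iff.1 h))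
  have hlast : r + 1 + (N - (r + 1)) = N := by omega
  simp only [hlast, add_zero] at hw₂ hc₂ hl₂
  have hU₁ : U ∪ segUnion E₁ ⊆ U ∪ segUnion (E₁ ∪ E₂) := by
    rw [segUnion_union]; exact Set.union_subset_union_right _ Set.subset_union_left
  have hU₂ : U ∪ segUnion E₂ ⊆ U ∪ segUnion (E₁ ∪ E₂) := by
    rw [segUnion_union]; exact Set.union_subset_union_right _ Set.subset_union_right
  refine ⟨E₁ ∪ E₂, ?_, ?_, ?_⟩
  · have h1 := gweight_union_le E₁ E₂
    have h2 := hrun 0 r (by omega) (by omega) habr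
    have h3 := hφ r (by omega)
    linarith
  · intro b a hba haN h
    rcases Nat.lt_or_ge a (r + 1) with har | har
    · exact (hc₁ b a hba (by omega) h).mono hU₁ le_rfl
    rcases Nat.lt_or_ge b (r + 1) with hbr | hbr
    · exfalso
      have h1 := h (r + 1) (by omega) har
      have h2 := habr b (by omega) (by omega)
      nlinarith
    · obtain ⟨b, rfl⟩ := Nat.exists_eq_add_of_le hbr
      obtain ⟨a, rfl⟩ := Nat.exists_eq_add_of_le har
      exact (hc₂ b a (by omega) (by omega) (above_shift_iff.2 h)).mono hU₂ le_rfl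
  · intro a ha
    rcases Nat.lt_or_ge a (r + 1) with har | har
    · exact ⟨0, by omega, by simp, (hc₁ 0 a (by omega) (by omega)
        fun k hk hka => habr k hk (by omega)).mono hU₁ le_rfl⟩
    · obtain ⟨a, rfl⟩ := Nat.exists_eq_add_of_le har
      obtain ⟨j, hja, hj, hc⟩ := hl₂ a (by omega)
      exact ⟨r + 1 + j, by omega, by nlinarith, hc.mono hU₂ le_rfl⟩

theorem segment_subset_segUnion {E : Finset (Plane × Plane)} {p q : Plane} (h : (p, q) ∈ E) :
    segment ℝ p q ⊆ segUnion E :=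
  Set.subset_biUnion_of_mem (u := fun e : Plane × Plane => segment ℝ e.1 e.2) h

theorem segUnion_mono {E F : Finset (Plane × Plane)} (h : E ⊆ F) : segUnion E ⊆ segUnion F :=
  Set.biUnion_subset_biUnion_left h

theorem norm_sub_le_of_steep {p q : Plane} {σ d : ℝ} (hσ : 0 < σ) (hd : 0 ≤ d)
    (h0 : |q 0 - p 0| ≤ d) (h1 : σ * d / 16 ≤ q 1 - p 1) :
    ‖q - p‖ ≤ q 1 - p 1 + 8 * (σ⁻¹ * d) := by
  have hs : 0 ≤ σ⁻¹ * d := by positivity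
  have hsd : σ * d * (σ⁻¹ * d) = d ^ 2 := by field_simp
  have hpos : 0 ≤ σ * d := by positivity
  refine Plane.norm_le_of_sq_le (by linarith) ?_
  simp only [PiLp.sub_apply]
  have := sq_abs (q 0 - p 0)
  nlinarith [abs_nonneg (q 0 - p 0), mul_le_mul_of_nonneg_right h1 hs]

set_option maxHeartbeats 1000000 in
/-- Paths that start with a vertical edge and rise with slope at least `σ / 8` from its lower end:
all later vertices below the ray of slope `σ` from its upper end can be well connected to its lower
end. -/
theorem exists_augment_hops {σ : ℝ} (hσ : 8 < σ) (hA : ∀ N, Augmentable (σ / 2) N) :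
    ∀ (N : ℕ) (P : ℕ → Plane) (X : ℕ → ℝ) (U : Set Plane), 1 ≤ N → Climbing N P X →
    (∀ i < N, segment ℝ (P i) (P (i + 1)) ⊆ U) → X 1 = X 0 →
    (∀ p ≤ N, P 0 1 + σ / 8 * (X p - X 0) ≤ P p 1) →
    ∃ Ex : Finset (Plane × Plane), gweight Ex ≤ 204 * (σ * (X N - X 0)) ∧
      ∀ p, 1 ≤ p → p ≤ N → P p 1 ≤ P 1 1 + σ * (X p - X 0) →
        Conn (U ∪ segUnion Ex) (P 0) (P p) (P p 1 - P 0 1 + 272 * (σ⁻¹ * (X p - X 0))) := by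
  intro N
  induction N using Nat.strong_induction_on with
  | _ N ih =>
  intro P X U hN hP hU hX1 hsteep
  have hσ0 : 0 < σ := by linarith
  have hσi : 0 < σ⁻¹ := inv_pos.2 hσ0
  rcases (hP.mono (Nat.zero_le N) le_rfl).eq_or_lt with hD | hD
  · refine ⟨∅, by simp [gweight, hD], fun p hp hpN _ => ?_⟩
    have h1 := hP.mono (Nat.zero_le p) hpN
    have h2 := hP.mono hpN le_rfl
    have h3 : X p = X 0 := by linarith
    refine (hP.conn hU (Nat.zero_le p) hpN).mono Set.subset_union_left ?_
    simp [h3]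
  obtain ⟨m, ⟨hmN, hm⟩, hmin⟩ : ∃ m, (m ≤ N ∧ 16 / 17 * (X N - X 0) < X m - X 0) ∧
      ∀ k < m, ¬(k ≤ N ∧ 16 / 17 * (X N - X 0) < X k - X 0) := by
    have hex : ∃ m, m ≤ N ∧ 16 / 17 * (X N - X 0) < X m - X 0 := ⟨N, le_rfl, by linarith⟩
    exact ⟨Nat.find hex, Nat.find_spec hex, fun m hm => Nat.find_min hex hm⟩
  have hm2 : 2 ≤ m := by
    by_contra! h
    have : X m = X 0 := by interval_cases m <;> simp [hX1]
    rw [this] at hm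
    linarith
  obtain ⟨m, rfl⟩ : ∃ k, m = k + 1 := ⟨m - 1, by omega⟩
  have hXm : X m - X 0 ≤ 16 / 17 * (X N - X 0) := by
    by_contra! h
    exact hmin m (by omega) ⟨by omega, h⟩
  obtain ⟨E₁, hw₁, hc₁⟩ := ih m (by omega) P X U (by omega) (hP.restrict (by omega))
    (fun i hi => hU i (by omega)) hX1 (fun p hp => hsteep p (by omega))
  by_cases hlow : ∃ k, m + 1 ≤ k ∧ k ≤ N ∧ P k 1 ≤ P 1 1 + σ * (X k - X 0)
  swap
  · push Not at hlow
    refine ⟨E₁, ?_, fun p hp hpN hpl => hc₁ p hp ?_ hpl⟩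
    · have := mul_le_mul_of_nonneg_left (hP.mono (show m ≤ N by omega) le_rfl) hσ0.le
      linarith
    · by_contra! h
      exact absurd hpl (not_le.2 (hlow p h hpN))
  obtain ⟨k, ⟨hmk, hkN, hk⟩, hkmin⟩ :
      ∃ k, (m + 1 ≤ k ∧ k ≤ N ∧ P k 1 ≤ P 1 1 + σ * (X k - X 0)) ∧
        ∀ j < k, ¬(m + 1 ≤ j ∧ j ≤ N ∧ P j 1 ≤ P 1 1 + σ * (X j - X 0)) :=
    ⟨Nat.find hlow, Nat.find_spec hlow, fun m hm => Nat.find_min hlow hm⟩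
  obtain ⟨d, hd⟩ : ∃ d, d = X k - X 0 := ⟨_, rfl⟩
  have hXmk := hP.mono hmk hkN
  have hXmk' := hP.mono (show m ≤ k by omega) hkN
  have hXkN := hP.mono hkN le_rfl
  have hd0 : 0 < d := by linarith
  have hσd : 0 < σ * d := by positivity
  rw [← hd] at hk
  have hy01 : P 0 1 ≤ P 1 1 := by
    have := (hP 0 (by omega)).2.2.1
    simp only [zero_add] at this
    linarith
  have hx01 : P 0 0 = P 1 0 := by
    have := (hP 0 (by omega)).2.1
    simp only [zero_add, hX1, sub_self] at this
    linarith [abs_nonpos_iff.1 this]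
  have hxk := hP.abs_fst_sub_le (Nat.zero_le k) hkN
  have hyk := hsteep k hkN
  rw [← hd] at hyk hxk
  -- the lower end of the slit below `P k`, and the start of the hop towards it
  obtain ⟨v, hv0, hv1⟩ : ∃ v : Plane, v 0 = P k 0 ∧ v 1 = P k 1 - σ * d / 16 :=
    ⟨pt (P k 0) (P k 1 - σ * d / 16), rfl, rfl⟩
  obtain ⟨h, hh0, hh1⟩ : ∃ h : Plane, h 0 = P 0 0 ∧ h 1 = max (P 0 1) (v 1 - 2 * (σ * d)) :=
    ⟨pt (P 0 0) (max (P 0 1) (v 1 - 2 * (σ * d))), rfl, rfl⟩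
  have hh_ge : P 0 1 ≤ h 1 := hh1 ▸ le_max_left _ _
  have hh_ge' : v 1 - 2 * (σ * d) ≤ h 1 := hh1 ▸ le_max_right _ _
  have hh_le : h 1 ≤ P 1 1 := by
    rw [hh1]
    exact max_le hy01 (by linarith)
  have hhv : σ * d / 16 ≤ v 1 - h 1 := by
    rw [hh1]
    rcases max_choice (P 0 1) (v 1 - 2 * (σ * d)) with h' | h' <;> rw [h'] <;> linarith
  have hAb : Above (fun i => Nat.casesOn i v fun j => P (k + j))
      (fun i => Nat.casesOn i (X k) fun j => X (k + j)) (σ / 2) 0 (N - k + 1) := by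
    rintro (_ | i) _ hi
    · simp
    · have h1 := hP.le_snd_sub (show k ≤ k + i by omega) (by omega)
      have h2 := hP.mono (show k + i ≤ N by omega) le_rfl
      have h3 := hP.mono (show k ≤ k + i by omega) (by omega)
      have h4 : X (k + i) - X k ≤ d / 16 := by linarith
      have h5 := mul_le_mul_of_nonneg_left h4 hσ0.le
      change v 1 + σ / 2 * (X (k + i) - X k) ≤ P (k + i) 1
      nlinarith
  obtain ⟨E₂, hw₂, hc₂⟩ := hA (N - k + 1) (fun i => Nat.casesOn i v fun j => P (k + j))
    (fun i => Nat.casesOn i (X k) fun j => X (k + j)) (U ∪ segment ℝ v (P k)) (by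
      rintro (_ | i) hi
      · refine ⟨le_rfl, ?_, ?_, Or.inr rfl⟩
        · simp [hv0]
        · change X k - X k ≤ P k 1 - v 1
          linarith
      · exact hP (k + i) (by omega)) (by
      rintro (_ | i) hi
      · exact Set.subset_union_right
      · exact (hU (k + i) (by omega)).trans Set.subset_union_left) hAb
  change gweight E₂ ≤ 272 * (σ / 2 * (X (k + (N - k)) - X k)) at hw₂
  rw [Nat.add_sub_cancel' hkN] at hw₂
  obtain ⟨E₃, hE₃⟩ : ∃ E₃ : Finset (Plane × Plane), E₃ = {(v, P k), (h, v)} := ⟨_, rfl⟩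
  have hvE : segment ℝ v (P k) ⊆ segUnion E₃ := segment_subset_segUnion (by simp [hE₃])
  have hhE : segment ℝ h v ⊆ segUnion E₃ := segment_subset_segUnion (by simp [hE₃])
  have hw₃ : gweight E₃ ≤ 4 * (σ * d) := by
    have h1 : ‖v - P k‖ ≤ σ * d / 16 := by
      refine (Plane.norm_le_abs_add_abs _).trans ?_
      simp only [PiLp.sub_apply, hv0, sub_self, abs_zero, zero_add]
      exact abs_le.2 ⟨by linarith, by linarith⟩
    have h2 : ‖h - v‖ ≤ d + 2 * (σ * d) := by
      refine (Plane.norm_le_abs_add_abs _).trans (add_le_add ?_ ?_)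
      · simpa only [PiLp.sub_apply, hh0, hv0, abs_sub_comm] using hxk
      · simp only [PiLp.sub_apply]
        exact abs_le.2 ⟨by linarith, by linarith⟩
    have h3 : gweight E₃ ≤ ‖v - P k‖ + ‖h - v‖ := by
      rw [hE₃, Finset.insert_eq]
      simpa [gweight] using gweight_union_le {(v, P k)} {(h, v)}
    nlinarith
  have hsub : U ∪ segment ℝ v (P k) ∪ segUnion E₂ ⊆ U ∪ segUnion (E₁ ∪ (E₂ ∪ E₃)) := by
    simp only [segUnion_union]
    exact Set.union_subset (Set.union_subset Set.subset_union_left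
      fun z hz => Or.inr (Or.inr (Or.inr (hvE hz)))) fun z hz => Or.inr (Or.inr (Or.inl hz))
  refine ⟨E₁ ∪ (E₂ ∪ E₃), ?_, fun p hp hpN hpl => ?_⟩
  · have h1 := gweight_union_le E₁ (E₂ ∪ E₃)
    have h2 := gweight_union_le E₂ E₃
    have h3 := mul_le_mul_of_nonneg_left hXm hσ0.le
    have h4 := mul_le_mul_of_nonneg_left hXmk' hσ0.le
    have h5 := mul_le_mul_of_nonneg_left (show d ≤ X N - X 0 by linarith) hσ0.le
    linarith
  rcases Nat.lt_or_ge p (m + 1) with hpm | hpm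
  · refine (hc₁ p hp (by omega) hpl).mono ?_ le_rfl
    rw [segUnion_union]
    exact Set.union_subset_union_right _ Set.subset_union_left
  have hkp : k ≤ p := by
    by_contra! hlt
    exact hkmin p hlt ⟨hpm, hpN, hpl⟩
  obtain ⟨j, rfl⟩ := Nat.exists_eq_add_of_le hkp
  have hvp := (hc₂ 0 (j + 1) (by omega) (by omega)
    fun i hi hij => hAb i hi (by omega)).mono hsub le_rfl
  have hcv : Conn (U ∪ segUnion (E₁ ∪ (E₂ ∪ E₃))) h v (v 1 - h 1 + 8 * (σ⁻¹ * d)) :=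
    Conn.of_segment (hhE.trans fun z hz => by simp [segUnion_union, hz])
      (norm_sub_le_of_steep hσ0 hd0.le (by rwa [hv0, hh0]) hhv)
  have hc0 : Conn (U ∪ segUnion (E₁ ∪ (E₂ ∪ E₃))) (P 0) h (h 1 - P 0 1) := by
    refine Conn.of_segment ?_ ?_
    · refine ((convex_segment _ _).segment_subset (left_mem_segment _ _ _)
        (mem_segment_of_vertical hx01 hh0 hh_ge hh_le)).trans ((hU 0 (by omega)).trans ?_)
      exact Set.subset_union_left
    · refine (Plane.norm_le_abs_add_abs _).trans ?_
      simp [hh0, abs_of_nonneg (sub_nonneg.2 hh_ge)]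
  refine ((hc0.trans hcv).trans hvp).mono subset_rfl ?_
  change h 1 - P 0 1 + (v 1 - h 1 + 8 * (σ⁻¹ * d)) +
    (P (k + j) 1 - v 1 + 272 * ((σ / 2)⁻¹ * (X (k + j) - X k))) ≤ _
  clear hvp hc₂ hAb
  have h1 := hP.mono hpN le_rfl
  have h2 := hP.mono hkp hpN
  have h3 := mul_le_mul_of_nonneg_left (show X (k + j) - X k ≤ d / 16 by linarith) hσi.le
  have h4 := mul_le_mul_of_nonneg_left (show d ≤ X (k + j) - X 0 by linarith) hσi.le
  have h5 : 0 < σ⁻¹ * d := by positivity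
  rw [inv_div, div_eq_mul_inv]
  linarith

theorem augmentable_of_half {σ : ℝ} (hσ : 8 < σ) (hA : ∀ N, Augmentable (σ / 2) N) (N : ℕ) :
    Augmentable σ N := by
  induction N using Nat.strong_induction_on with
  | _ N ih =>
  intro P X U hP hU hab
  have hσ0 : 0 < σ := by linarith
  rcases Nat.eq_zero_or_pos N with rfl | hN
  · refine ⟨∅, by simp [gweight], fun b a hba ha _ => ?_⟩
    obtain rfl : a = 0 := by omega
    obtain rfl : b = 0 := by omega
    exact .refl _ (by simp)
  obtain ⟨l, hlN, hl, hlmax⟩ : ∃ l < N, P l 1 ≤ P N 1 - σ / 8 * (X N - X l) ∧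
      ∀ k, l < k → k < N → P N 1 - σ / 8 * (X N - X k) < P k 1 := by
    have h0 : P 0 1 ≤ P N 1 - σ / 8 * (X N - X 0) := by
      have h1 := hab N (by omega) le_rfl
      have h2 := mul_nonneg hσ0.le (sub_nonneg.2 (hP.mono (Nat.zero_le N) le_rfl))
      linarith
    let Q : ℕ → Prop := fun l => P l 1 ≤ P N 1 - σ / 8 * (X N - X l)
    refine ⟨Nat.findGreatest Q (N - 1), ?_, Nat.findGreatest_spec (P := Q) (Nat.zero_le _) h0,
      fun k hk hkN => ?_⟩
    · have := Nat.findGreatest_le (P := Q) (N - 1)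
      omega
    · exact not_le.1 (Nat.findGreatest_is_greatest (P := Q) hk (by omega))
  have hsteep : ∀ p, l ≤ p → p ≤ N → P l 1 + σ / 8 * (X p - X l) ≤ P p 1 := by
    intro p hlp hpN
    rcases hlp.eq_or_lt with rfl | hlp
    · simp
    rcases hpN.eq_or_lt with rfl | hpN
    · linarith
    · linarith [hlmax p hlp hpN]
  have hX1 : X (l + 1) = X l := by
    obtain ⟨h1, -, -, h2 | h2⟩ := hP l hlN
    · have h3 := hsteep (l + 1) (by omega) (by omega)
      nlinarith
    · exact h2
  have hlast : l + 1 + (N - (l + 1)) = N := by omega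
  have hlast' : l + (N - l) = N := by omega
  obtain ⟨E₁, hw₁, hc₁⟩ := ih l hlN P X U (hP.restrict hlN.le) (fun i hi => hU i (by omega))
    (fun k hk hkl => hab k hk (by omega))
  obtain ⟨E₂, hw₂, hc₂⟩ := exists_augment_hops hσ hA (N - l) (fun i => P (l + i))
    (fun i => X (l + i)) U (by omega) (hP.shift (by omega)) (fun i hi => hU (l + i) (by omega)) hX1
    (fun p hp => hsteep (l + p) (by omega) (by omega))
  obtain ⟨E₃, hw₃, hc₃, hr₃⟩ := exists_augment_pieces (σ := σ) (M := N - (l + 1))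
    (fun M hM => ih M (by omega)) (N - (l + 1)) le_rfl (fun i => P (l + 1 + i))
    (fun i => X (l + 1 + i)) (fun i => P (l + 1 + i) 1 + X (l + 1 + i)) U (hP.shift (by omega))
    (fun i hi => hU (l + 1 + i) (by omega)) (fun i hi => by
      have := (hP (l + 1 + i) (by omega)).2.2.1
      simp only [← add_assoc]
      linarith) (fun j r hjr hr h => by
      have h1 := h r hjr le_rfl
      have h2 := hP.mono (show l + 1 + j ≤ l + 1 + r by omega) (by omega)
      simp only at h1 ⊢
      linarith)
  simp only [hlast, hlast', add_zero] at hw₂ hw₃ hc₂ hc₃ hr₃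
  have hsub₁ : U ∪ segUnion E₁ ⊆ U ∪ segUnion (E₁ ∪ (E₂ ∪ E₃)) :=
    Set.union_subset_union_right _ (segUnion_mono fun e he => by simp [he])
  have hsub₂ : U ∪ segUnion E₂ ⊆ U ∪ segUnion (E₁ ∪ (E₂ ∪ E₃)) :=
    Set.union_subset_union_right _ (segUnion_mono fun e he => by simp [he])
  have hsub₃ : U ∪ segUnion E₃ ⊆ U ∪ segUnion (E₁ ∪ (E₂ ∪ E₃)) :=
    Set.union_subset_union_right _ (segUnion_mono fun e he => by simp [he])
  refine ⟨E₁ ∪ (E₂ ∪ E₃), ?_, fun b a hba haN h => ?_⟩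
  · have h1 := gweight_union_le E₁ (E₂ ∪ E₃)
    have h2 := gweight_union_le E₂ E₃
    have h3 : P N 1 - P (l + 1) 1 ≤ σ / 8 * (X N - X l) := by
      rcases (Nat.succ_le_of_lt hlN).eq_or_lt with h | h
      · have h3 := mul_nonneg hσ0.le (sub_nonneg.2 (hP.mono hlN.le le_rfl))
        rw [Nat.succ_eq_add_one] at h
        rw [h]
        linarith
      · linarith [hlmax (l + 1) (by omega) h, congrArg (σ * ·) hX1]
    have h4 := hP.mono hlN.le le_rfl
    nlinarith
  rcases Nat.lt_or_ge l a with hla | hla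
  swap
  · exact (hc₁ b a hba hla h).mono hsub₁ le_rfl
  obtain ⟨a, rfl⟩ := Nat.exists_eq_add_of_le (Nat.succ_le_of_lt hla)
  rw [Nat.succ_eq_add_one] at *
  rcases Nat.lt_or_ge l b with hlb | hlb
  · obtain ⟨b, rfl⟩ := Nat.exists_eq_add_of_le (Nat.succ_le_of_lt hlb)
    exact (hc₃ b a (by omega) (by omega) (above_shift_iff.2 h)).mono hsub₃ le_rfl
  obtain ⟨j, hja, hj, hc⟩ := hr₃ a (by omega)
  have hcl := hc₂ (1 + j) (by omega) (by omega) (by simpa only [← add_assoc, hX1] using hj)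
  have hcb := hc₁ b l hlb le_rfl fun k hk hkl => h k hk (by omega)
  rw [← add_assoc] at hcl
  refine (((hcb.mono hsub₁ le_rfl).trans (hcl.mono hsub₂ le_rfl)).trans
    (hc.mono hsub₃ le_rfl)).mono subset_rfl ?_
  linarith

theorem augmentable {σ : ℝ} (hσ : 0 < σ) (N : ℕ) : Augmentable σ N := by
  obtain ⟨n, hn⟩ : ∃ n : ℕ, σ ≤ 8 * 2 ^ n := by
    obtain ⟨n, hn⟩ := pow_unbounded_of_one_lt σ one_lt_two
    exact ⟨n, by linarith⟩
  induction n generalizing σ N with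
  | succ n ih =>
    rcases le_or_gt σ 8 with h | h
    · exact ih hσ N (h.trans (by linarith [one_le_pow₀ (M₀ := ℝ) one_le_two (n := n)]))
    · exact augmentable_of_half h (fun M => ih (by linarith) M (by rw [pow_succ] at hn; linarith)) N
  | zero =>
    intro P X U hP hU _
    have h0 := mul_nonneg hσ.le (sub_nonneg.2 (hP.mono (Nat.zero_le N) le_rfl))
    refine ⟨∅, by simpa [gweight] using h0, fun b a hba ha _ => ?_⟩
    refine (hP.conn hU hba ha).mono Set.subset_union_left ?_
    have h1 : 1 / 8 ≤ σ⁻¹ := by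
      rw [one_div]
      exact inv_anti₀ hσ (by simpa using hn)
    have h2 := mul_le_mul_of_nonneg_right h1 (sub_nonneg.2 (hP.mono hba ha))
    linarith [hP.mono hba ha]

/-- The arc length from `u 0` along the path `u` to a point `a` on its `i`-th edge. -/
def arcPos (u : ℕ → Plane) (i : ℕ) (a : Plane) : ℝ :=
  ∑ k ∈ Finset.range i, ‖u (k + 1) - u k‖ + ‖a - u i‖

/-- Tame paths, traversed from left to right (`c = 1`) or from right to left (`c = -1`). -/
structure TameSeq (c : ℝ) (n : ℕ) (u : ℕ → Plane) : Prop where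
  rect : IsRectilinear n u
  mono : ∀ i < n, c * u i 0 ≤ c * u (i + 1) 0
  tame : ∀ (i j : ℕ) (a b : Plane), i ≤ j → j < n →
    a ∈ segment ℝ (u i) (u (i + 1)) → b ∈ segment ℝ (u j) (u (j + 1)) →
    a 1 = b 1 → segment ℝ a b ⊆ belowRegion (pathSet n u) →
    arcPos u j b - arcPos u i a ≤ 2 * ‖a - b‖

theorem IsTamePath.tameSeq {n : ℕ} {u : ℕ → Plane} (h : IsTamePath n u) : TameSeq 1 n u := by
  obtain ⟨h1, h2, h3⟩ := h
  refine ⟨h1, by simpa using h2, fun i j a b hij hj ha hb hab hsub => ?_⟩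
  have h := h3 i j a b hij hj ha hb hab hsub
  refine le_trans ?_ h
  unfold subLen arcPos
  split_ifs with heq
  · subst heq
    have := norm_sub_norm_le (b - u i) (a - u i)
    rw [sub_sub_sub_cancel_right] at this
    linarith
  · have hs := Finset.sum_range_add_sum_Ico (fun k => ‖u (k + 1) - u k‖) (show i + 1 ≤ j by omega)
    rw [Finset.sum_range_succ] at hs
    have := norm_add_le (u (i + 1) - a) (a - u i)
    rw [sub_add_sub_cancel] at this
    linarith

theorem mem_pathSet {n : ℕ} {u : ℕ → Plane} {z : Plane} :
    z ∈ pathSet n u ↔ ∃ i < n, z ∈ segment ℝ (u i) (u (i + 1)) := by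
  simp [pathSet]

theorem segUnion_pathEdges (n : ℕ) (u : ℕ → Plane) : segUnion (pathEdges n u) = pathSet n u := by
  ext z
  simp [segUnion, pathEdges, mem_pathSet]

theorem norm_sub_add_norm_sub {p q z : Plane} (h : z ∈ segment ℝ p q) :
    ‖z - p‖ + ‖q - z‖ = ‖q - p‖ := by
  simpa [dist_eq_norm, norm_sub_rev] using dist_add_dist_of_mem_segment h

/-- The path `u` with an additional vertex `z` after `u m`. -/
def insertVertex (u : ℕ → Plane) (m : ℕ) (z : Plane) (i : ℕ) : Plane :=
  if i ≤ m then u i else if i = m + 1 then z else u (i - 1)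

section insertVertex

variable {u : ℕ → Plane} {m : ℕ} {z : Plane}

theorem insertVertex_of_le {i : ℕ} (h : i ≤ m) : insertVertex u m z i = u i := if_pos h

theorem insertVertex_self : insertVertex u m z (m + 1) = z := by simp [insertVertex]

theorem insertVertex_succ {i : ℕ} (h : m < i) : insertVertex u m z (i + 1) = u i := by
  rw [insertVertex, if_neg (by omega), if_neg (by omega), Nat.add_sub_cancel]

theorem sum_insertVertex_of_le {i : ℕ} (h : i ≤ m) :
    ∑ k ∈ Finset.range i, ‖insertVertex u m z (k + 1) - insertVertex u m z k‖ =
      ∑ k ∈ Finset.range i, ‖u (k + 1) - u k‖ := by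
  refine Finset.sum_congr rfl fun k hk => ?_
  rw [Finset.mem_range] at hk
  rw [insertVertex_of_le (by omega), insertVertex_of_le (by omega)]

theorem sum_insertVertex_succ (hz : z ∈ segment ℝ (u m) (u (m + 1))) {i : ℕ} (h : m + 1 ≤ i) :
    ∑ k ∈ Finset.range (i + 1), ‖insertVertex u m z (k + 1) - insertVertex u m z k‖ =
      ∑ k ∈ Finset.range i, ‖u (k + 1) - u k‖ := by
  induction i, h using Nat.le_induction with
  | base =>
    rw [Finset.sum_range_succ, Finset.sum_range_succ, sum_insertVertex_of_le le_rfl,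
      insertVertex_self, insertVertex_of_le le_rfl, insertVertex_succ (by omega), add_assoc,
      norm_sub_add_norm_sub hz, Finset.sum_range_succ]
  | succ i hi ih =>
    rw [Finset.sum_range_succ, ih, insertVertex_succ (by omega), insertVertex_succ (by omega),
      Finset.sum_range_succ]

/-- Every edge of the subdivided path is part of an edge of the original path. -/
theorem insertVertex_edge (hz : z ∈ segment ℝ (u m) (u (m + 1))) (i : ℕ) {a : Plane}
    (ha : a ∈ segment ℝ (insertVertex u m z i) (insertVertex u m z (i + 1))) :
    a ∈ segment ℝ (u (if i ≤ m then i else i - 1)) (u ((if i ≤ m then i else i - 1) + 1)) ∧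
      arcPos (insertVertex u m z) i a = arcPos u (if i ≤ m then i else i - 1) a := by
  unfold arcPos
  rcases lt_trichotomy i m with h | rfl | h
  · rw [insertVertex_of_le (by omega), insertVertex_of_le (by omega)] at ha
    rw [if_pos (by omega), sum_insertVertex_of_le h.le, insertVertex_of_le h.le]
    exact ⟨ha, rfl⟩
  · rw [insertVertex_of_le le_rfl, insertVertex_self] at ha
    rw [if_pos le_rfl, sum_insertVertex_of_le le_rfl, insertVertex_of_le le_rfl]
    exact ⟨(convex_segment _ _).segment_subset (left_mem_segment _ _ _) hz ha, rfl⟩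
  · obtain ⟨i, rfl⟩ : ∃ j, i = j + 1 := ⟨i - 1, by omega⟩
    rw [if_neg (by omega), Nat.add_sub_cancel]
    rcases (show m ≤ i by omega).eq_or_lt with rfl | h'
    · rw [insertVertex_self, insertVertex_succ (by omega)] at ha
      refine ⟨(convex_segment _ _).segment_subset hz (right_mem_segment _ _ _) ha, ?_⟩
      have hza : z ∈ segment ℝ (u m) a := by
        rw [mem_segment_iff_wbtw] at *
        exact hz.trans_right_left ha
      rw [Finset.sum_range_succ, sum_insertVertex_of_le le_rfl, insertVertex_self,
        insertVertex_of_le le_rfl, add_assoc, norm_sub_add_norm_sub hza]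
    · rw [insertVertex_succ h', insertVertex_succ (by omega)] at ha
      rw [sum_insertVertex_succ hz h', insertVertex_succ h']
      exact ⟨ha, rfl⟩

theorem pathSet_insertVertex {n : ℕ} (hm : m < n) (hz : z ∈ segment ℝ (u m) (u (m + 1))) :
    pathSet (n + 1) (insertVertex u m z) = pathSet n u := by
  ext a
  simp only [mem_pathSet]
  constructor
  · rintro ⟨i, hi, ha⟩
    exact ⟨_, by split_ifs <;> omega, (insertVertex_edge hz i ha).1⟩
  · rintro ⟨i, hi, ha⟩
    rcases lt_trichotomy i m with h | rfl | h
    · exact ⟨i, by omega, by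
        rwa [insertVertex_of_le (by omega), insertVertex_of_le (by omega)]⟩
    · have hcase : a ∈ segment ℝ (u i) z ∨ a ∈ segment ℝ z (u (i + 1)) := by
        simp only [mem_segment_iff_wbtw] at hz ha ⊢
        obtain ⟨s, hs, rfl⟩ := hz
        obtain ⟨t, ht, rfl⟩ := ha
        rcases wbtw_or_wbtw_smul_vadd_of_nonneg (u i) (u (i + 1) -ᵥ u i) hs.1 ht.1 with h | h
        · exact Or.inr (Wbtw.trans_left_right (⟨t, ht, rfl⟩ : Wbtw ℝ (u i) _ (u (i + 1))) h)
        · exact Or.inl h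
      rcases hcase with h | h
      · exact ⟨i, by omega, by rwa [insertVertex_of_le le_rfl, insertVertex_self]⟩
      · exact ⟨i + 1, by omega, by rwa [insertVertex_self, insertVertex_succ (by omega)]⟩
    · exact ⟨i + 1, by omega, by rwa [insertVertex_succ h, insertVertex_succ (by omega)]⟩

theorem TameSeq.subdivide {c : ℝ} {n : ℕ} (h : TameSeq c n u) (hm : m < n)
    (hz : z ∈ segment ℝ (u m) (u (m + 1))) : TameSeq c (n + 1) (insertVertex u m z) := by
  have hz' := hz
  obtain ⟨s, t, hs, ht, hst, hzst⟩ := hz'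
  have hcoord : ∀ i, z i = s * u m i + t * u (m + 1) i := fun i => by rw [← hzst]; simp
  have hs' : s = 1 - t := by linarith
  refine ⟨fun i hi => ?_, fun i hi => ?_, fun i j a b hij hj ha hb hab hsub => ?_⟩
  · rcases lt_trichotomy i m with h' | rfl | h'
    · rw [insertVertex_of_le (by omega), insertVertex_of_le (by omega)]
      exact h.rect i (by omega)
    · rw [insertVertex_of_le le_rfl, insertVertex_self, hcoord, hcoord, hs']
      rcases h.rect i hm with h'' | h''
      · left; rw [← h'']; ring
      · right; rw [← h'']; ring
    · obtain ⟨i, rfl⟩ : ∃ j, i = j + 1 := ⟨i - 1, by omega⟩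
      rcases (show m ≤ i by omega).eq_or_lt with rfl | h'
      · rw [insertVertex_self, insertVertex_succ (by omega), hcoord, hcoord, hs']
        rcases h.rect m hm with h'' | h''
        · left; rw [← h'']; ring
        · right; rw [← h'']; ring
      · rw [insertVertex_succ h', insertVertex_succ (by omega)]
        exact h.rect i (by omega)
  · rcases lt_trichotomy i m with h' | rfl | h'
    · rw [insertVertex_of_le (by omega), insertVertex_of_le (by omega)]
      exact h.mono i (by omega)
    · rw [insertVertex_of_le le_rfl, insertVertex_self, hcoord, hs']
      nlinarith [h.mono i hm]
    · obtain ⟨i, rfl⟩ : ∃ j, i = j + 1 := ⟨i - 1, by omega⟩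
      rcases (show m ≤ i by omega).eq_or_lt with rfl | h'
      · rw [insertVertex_self, insertVertex_succ (by omega), hcoord, hs']
        nlinarith [h.mono m hm]
      · rw [insertVertex_succ h', insertVertex_succ (by omega)]
        exact h.mono i (by omega)
  · obtain ⟨ha', ha⟩ := insertVertex_edge hz i ha
    obtain ⟨hb', hb⟩ := insertVertex_edge hz j hb
    rw [pathSet_insertVertex hm hz] at hsub
    rw [ha, hb]
    exact h.tame _ _ a b (by split_ifs <;> omega) (by split_ifs <;> omega) ha' hb' hab hsub

end insertVertex

/-- A tame path can be subdivided so that finitely many given points on it become vertices. -/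
theorem TameSeq.exists_refinement {c : ℝ} {n : ℕ} {u : ℕ → Plane} (h : TameSeq c n u)
    (S : Finset Plane) (hS : ↑S ⊆ pathSet n u) :
    ∃ (m : ℕ) (v : ℕ → Plane), TameSeq c m v ∧ pathSet m v = pathSet n u ∧ v 0 = u 0 ∧
      v m = u n ∧ ∀ a ∈ S, ∃ i ≤ m, v i = a := by
  induction S using Finset.induction_on with
  | empty => exact ⟨n, u, h, rfl, rfl, rfl, by simp⟩
  | insert z S _ ih =>
    rw [Finset.coe_insert, Set.insert_subset_iff] at hS
    obtain ⟨m, v, hv, hset, h0, hm, hvert⟩ := ih hS.2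
    obtain ⟨k, hk, hz⟩ := mem_pathSet.1 (hset ▸ hS.1)
    refine ⟨m + 1, insertVertex v k z, hv.subdivide hk hz,
      (pathSet_insertVertex hk hz).trans hset, ?_, ?_, fun a ha => ?_⟩
    · rw [insertVertex_of_le (Nat.zero_le k), h0]
    · rw [insertVertex_succ hk, hm]
    · rcases Finset.mem_insert.1 ha with rfl | ha
      · exact ⟨k + 1, by omega, insertVertex_self⟩
      · obtain ⟨i, hi, rfl⟩ := hvert a ha
        rcases Nat.lt_or_ge k i with hki | hki
        · exact ⟨i + 1, by omega, insertVertex_succ hki⟩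
        · exact ⟨i, by omega, insertVertex_of_le hki⟩

section reverse

variable {n : ℕ} {u : ℕ → Plane}

theorem sum_reverse {i : ℕ} (hi : i ≤ n) :
    ∑ k ∈ Finset.range i, ‖u (n - (k + 1)) - u (n - k)‖ =
      ∑ k ∈ Finset.range n, ‖u (k + 1) - u k‖ - ∑ k ∈ Finset.range (n - i), ‖u (k + 1) - u k‖ := by
  induction i with
  | zero => simp
  | succ i ih =>
    obtain ⟨k, rfl⟩ : ∃ k, n = k + 1 + i := ⟨n - i - 1, by omega⟩
    rw [Finset.sum_range_succ, ih (by omega), show k + 1 + i - i = k + 1 by omega,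
      show k + 1 + i - (i + 1) = k by omega, Finset.sum_range_succ (n := k), norm_sub_rev]
    ring

theorem arcPos_reverse {i : ℕ} (hi : i < n) {a : Plane}
    (ha : a ∈ segment ℝ (u (n - i)) (u (n - (i + 1)))) :
    arcPos (fun k => u (n - k)) i a =
      ∑ k ∈ Finset.range n, ‖u (k + 1) - u k‖ - arcPos u (n - (i + 1)) a := by
  unfold arcPos
  have h1 := norm_sub_add_norm_sub ha
  rw [sum_reverse hi.le]
  obtain ⟨k, rfl⟩ : ∃ k, n = k + 1 + i := ⟨n - i - 1, by omega⟩
  simp only [show k + 1 + i - i = k + 1 by omega, show k + 1 + i - (i + 1) = k by omega] at h1 ⊢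
  rw [Finset.sum_range_succ (n := k), norm_sub_rev (u (k + 1)), ← h1, norm_sub_rev a (u k)]
  ring

theorem pathSet_reverse : pathSet n (fun k => u (n - k)) = pathSet n u := by
  ext z
  simp only [mem_pathSet]
  constructor
  · rintro ⟨i, hi, hz⟩
    refine ⟨n - (i + 1), by omega, ?_⟩
    rwa [segment_symm, show n - (i + 1) + 1 = n - i by omega]
  · rintro ⟨i, hi, hz⟩
    refine ⟨n - (i + 1), by omega, ?_⟩
    rwa [segment_symm, show n - (n - (i + 1)) = i + 1 by omega,
      show n - (n - (i + 1) + 1) = i by omega]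

theorem TameSeq.reverse {c : ℝ} (h : TameSeq c n u) : TameSeq (-c) n (fun k => u (n - k)) := by
  refine ⟨fun i hi => ?_, fun i hi => ?_, fun i j a b hij hj ha hb hab hsub => ?_⟩
  · have := h.rect (n - (i + 1)) (by omega)
    rw [show n - (i + 1) + 1 = n - i by omega] at this
    exact this.imp Eq.symm Eq.symm
  · have := h.mono (n - (i + 1)) (by omega)
    rw [show n - (i + 1) + 1 = n - i by omega] at this
    linarith
  · rw [arcPos_reverse hj hb, arcPos_reverse (by omega) ha, sub_sub_sub_cancel_left, norm_sub_rev]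
    refine h.tame _ _ b a (by omega) (by omega) ?_ ?_ hab.symm ?_
    · rwa [segment_symm, show n - (j + 1) + 1 = n - j by omega]
    · rwa [segment_symm, show n - (i + 1) + 1 = n - i by omega]
    · rwa [segment_symm, ← pathSet_reverse]

end reverse

theorem le_mul_fst_of_mem_segment {p q z : Plane} (hz : z ∈ segment ℝ p q) {c x : ℝ}
    (hp : x ≤ c * p 0) (hq : x ≤ c * q 0) : x ≤ c * z 0 := by
  obtain ⟨s, t, hs, ht, hst, rfl⟩ := hz
  simp only [PiLp.add_apply, PiLp.smul_apply, smul_eq_mul]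
  nlinarith [mul_le_mul_of_nonneg_left hp hs, mul_le_mul_of_nonneg_left hq ht,
    congrArg (· * x) hst]

theorem le_snd_of_mem_segment {p q z : Plane} (hz : z ∈ segment ℝ p q) {y : ℝ}
    (hp : y ≤ p 1) (hq : y ≤ q 1) : y ≤ z 1 := by
  obtain ⟨s, t, hs, ht, hst, rfl⟩ := hz
  simp only [PiLp.add_apply, PiLp.smul_apply, smul_eq_mul]
  nlinarith [mul_le_mul_of_nonneg_left hp hs, mul_le_mul_of_nonneg_left hq ht,
    congrArg (· * y) hst]

theorem snd_le_of_mem_segment {p q z : Plane} (hz : z ∈ segment ℝ p q) {y : ℝ}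
    (hp : p 1 ≤ y) (hq : q 1 ≤ y) : z 1 ≤ y := by
  obtain ⟨s, t, hs, ht, hst, rfl⟩ := hz
  simp only [PiLp.add_apply, PiLp.smul_apply, smul_eq_mul]
  nlinarith [mul_le_mul_of_nonneg_left hp hs, mul_le_mul_of_nonneg_left hq ht,
    congrArg (· * y) hst]

theorem exists_mem_segment_fst_eq {p q : Plane} {c x : ℝ} (hc : c * c = 1) (hp : c * p 0 ≤ c * x)
    (hq : c * x ≤ c * q 0) : ∃ z ∈ segment ℝ p q, z 0 = x := by
  have hx : c * x ∈ segment ℝ (c * p 0) (c * q 0) := by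
    rw [segment_eq_Icc (hp.trans hq)]
    exact ⟨hp, hq⟩
  obtain ⟨s, t, hs, ht, hst, h⟩ := hx
  refine ⟨s • p + t • q, ⟨s, t, hs, ht, hst, rfl⟩, ?_⟩
  simp only [PiLp.add_apply, PiLp.smul_apply, smul_eq_mul] at h ⊢
  linear_combination c * h - (s * p 0 + t * q 0 - x) * hc

/-- The total length by which the path `u` descends before its `i`-th vertex. -/
def descent (u : ℕ → Plane) (i : ℕ) : ℝ :=
  ∑ k ∈ Finset.range i, max (u k 1 - u (k + 1) 1) 0

theorem descent_succ (u : ℕ → Plane) (i : ℕ) :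
    descent u (i + 1) = descent u i + max (u i 1 - u (i + 1) 1) 0 :=
  Finset.sum_range_succ _ _

theorem descent_sub_le (u : ℕ → Plane) {i j : ℕ} (hij : i ≤ j) :
    descent u j - descent u i ≤
      ∑ k ∈ Finset.range j, ‖u (k + 1) - u k‖ - ∑ k ∈ Finset.range i, ‖u (k + 1) - u k‖ := by
  induction j, hij using Nat.le_induction with
  | base => simp
  | succ j _ ih =>
    rw [descent_succ, Finset.sum_range_succ]
    have h1 := Plane.abs_snd_le_norm (u (j + 1) - u j)
    have h2 : max (u j 1 - u (j + 1) 1) 0 ≤ |(u (j + 1) - u j) 1| := by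
      rw [PiLp.sub_apply, abs_sub_comm]
      exact max_le (le_abs_self _) (abs_nonneg _)
    linarith

theorem arcPos_succ (u : ℕ → Plane) (i : ℕ) :
    arcPos u i (u (i + 1)) = ∑ k ∈ Finset.range (i + 1), ‖u (k + 1) - u k‖ := by
  rw [arcPos, Finset.sum_range_succ]

theorem arcPos_add_norm (u : ℕ → Plane) {i : ℕ} {q : Plane}
    (hq : q ∈ segment ℝ (u i) (u (i + 1))) :
    arcPos u i q + ‖u (i + 1) - q‖ = ∑ k ∈ Finset.range (i + 1), ‖u (k + 1) - u k‖ := by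
  rw [arcPos, Finset.sum_range_succ, add_assoc, norm_sub_add_norm_sub hq]

theorem mem_belowRegion_of_mem {L : Set Plane} {z : Plane} (hz : z ∈ L) : z ∈ belowRegion L :=
  ⟨⟨z, hz, rfl, le_rfl⟩, z, hz, le_rfl⟩

namespace TameSeq

variable {c : ℝ} {n : ℕ} {u : ℕ → Plane}

theorem mono_of_le (h : TameSeq c n u) {i j : ℕ} (hij : i ≤ j) (hj : j ≤ n) :
    c * u i 0 ≤ c * u j 0 := by
  induction j, hij using Nat.le_induction with
  | base => rfl
  | succ k _ ih => exact (ih (by omega)).trans (h.mono k (by omega))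

theorem exists_mem_pathSet_above (h : TameSeq c n u) (hc : c * c = 1) (hn : 0 < n) {k r : ℕ}
    (hkr : k ≤ r) (hr : r ≤ n) {x y : ℝ} (hy : ∀ p, k ≤ p → p ≤ r → y ≤ u p 1)
    (hk : c * u k 0 ≤ c * x) (hx : c * x ≤ c * u r 0) : ∃ z ∈ pathSet n u, z 0 = x ∧ y ≤ z 1 := by
  induction r, hkr using Nat.le_induction with
  | base =>
    have hxk : u k 0 = x := by
      linear_combination c * (le_antisymm hk hx) - (u k 0 - x) * hc
    refine ⟨u k, mem_pathSet.2 ?_, hxk, hy k le_rfl le_rfl⟩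
    rcases hr.eq_or_lt with rfl | hkn
    · obtain ⟨k, rfl⟩ : ∃ j, k = j + 1 := ⟨k - 1, by omega⟩
      exact ⟨k, by omega, right_mem_segment _ _ _⟩
    · exact ⟨k, hkn, left_mem_segment _ _ _⟩
  | succ r hkr ih =>
    rcases le_total (c * x) (c * u r 0) with h' | h'
    · exact ih (by omega) (fun p hp hpr => hy p hp (by omega)) h'
    · obtain ⟨z, hz, hz0⟩ := exists_mem_segment_fst_eq hc h' hx
      exact ⟨z, mem_pathSet.2 ⟨r, by omega, hz⟩, hz0,
        le_snd_of_mem_segment hz (hy r hkr (by omega)) (hy (r + 1) (by omega) le_rfl)⟩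

/-- On a stretch that does not go below its first vertex, the total descent is bounded by the
horizontal extent. -/
theorem descent_le (h : TameSeq c n u) (hc : c * c = 1) {j r : ℕ} (hjr : j ≤ r) (hr : r ≤ n)
    (hy : ∀ p, j ≤ p → p ≤ r → u j 1 ≤ u p 1) :
    descent u r - descent u j ≤ 2 * (c * u r 0 - c * u j 0) := by
  induction r using Nat.strong_induction_on with
  | _ r ih =>
  rcases hjr.eq_or_lt with rfl | hjr
  · simp
  obtain ⟨r, rfl⟩ : ∃ k, r = k + 1 := ⟨r - 1, by omega⟩
  rcases le_or_gt (u r 1) (u (r + 1) 1) with hup | hdown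
  · have h1 := ih r (by omega) (by omega) (by omega) fun p hp hpr => hy p hp (by omega)
    have h2 := h.mono r (by omega)
    rw [descent_succ, max_eq_right (by linarith)]
    linarith
  obtain ⟨k, hjk, hkr, hk, hkmax⟩ : ∃ k, j ≤ k ∧ k < r ∧ u k 1 ≤ u (r + 1) 1 ∧
      ∀ p, k < p → p ≤ r → u (r + 1) 1 < u p 1 := by
    let Q : ℕ → Prop := fun k => u k 1 ≤ u (r + 1) 1
    have hj : Q j := hy (r + 1) (by omega) le_rfl
    have hspec : Q (Nat.findGreatest Q r) := Nat.findGreatest_spec (P := Q) (by omega) hj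
    refine ⟨Nat.findGreatest Q r, Nat.le_findGreatest (P := Q) (by omega) hj, ?_, hspec,
      fun p hp hpr => not_le.1 (Nat.findGreatest_is_greatest (P := Q) hp hpr)⟩
    refine lt_of_le_of_ne (Nat.findGreatest_le (P := Q) r) fun heq => ?_
    rw [heq] at hspec
    exact absurd hspec (not_le.2 hdown)
  have hk1 := hkmax (k + 1) (by omega) (by omega)
  have hxk : u k 0 = u (k + 1) 0 := (h.rect k (by omega)).resolve_right (by linarith)
  obtain ⟨q, hq0, hq1⟩ : ∃ q : Plane, q 0 = u k 0 ∧ q 1 = u (r + 1) 1 :=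
    ⟨pt (u k 0) (u (r + 1) 1), rfl, rfl⟩
  have hq : q ∈ segment ℝ (u k) (u (k + 1)) :=
    mem_segment_of_vertical hxk hq0 (by linarith) (by linarith)
  have hmono := h.mono_of_le (show k ≤ r + 1 by omega) hr
  have hrmem : u (r + 1) ∈ pathSet n u :=
    mem_pathSet.2 ⟨r, by omega, right_mem_segment _ _ _⟩
  have hchord : segment ℝ q (u (r + 1)) ⊆ belowRegion (pathSet n u) := by
    intro z hz
    have hz1 : z 1 = u (r + 1) 1 :=
      le_antisymm (snd_le_of_mem_segment hz hq1.le le_rfl)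
        (le_snd_of_mem_segment hz hq1.ge le_rfl)
    refine ⟨?_, u (r + 1), hrmem, hz1.ge⟩
    rw [hz1]
    refine h.exists_mem_pathSet_above hc (by omega) (show k + 1 ≤ r + 1 by omega) hr ?_ ?_ ?_
    · intro p hp hpr
      rcases hpr.eq_or_lt with rfl | hpr
      · rfl
      · exact (hkmax p (by omega) (by omega)).le
    · rw [← hxk]
      exact le_mul_fst_of_mem_segment hz (by rw [hq0]) hmono
    · have := le_mul_fst_of_mem_segment hz (c := -c) (x := -(c * u (r + 1) 0))
        (by rw [hq0]; linarith) (by linarith)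
      linarith
  have ht := h.tame k r q (u (r + 1)) hkr.le (by omega) hq (right_mem_segment _ _ _) hq1 hchord
  have hnorm : ‖q - u (r + 1)‖ ≤ c * u (r + 1) 0 - c * u k 0 := by
    refine Plane.norm_le_of_sq_le (by linarith) ?_
    simp only [PiLp.sub_apply, hq0, hq1]
    nlinarith [congrArg (· * (u (r + 1) 0 - u k 0) ^ 2) hc]
  have h1 := arcPos_add_norm u hq
  have h2 := descent_sub_le u (show k + 1 ≤ r + 1 by omega)
  have h3 := descent_succ u k
  rw [max_eq_right (by linarith)] at h3
  rw [arcPos_succ] at ht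
  have h4 := ih k (by omega) hjk (by omega) fun p hp hpk => hy p hp (by omega)
  linarith [norm_nonneg (u (k + 1) - q)]

theorem climbing (h : TameSeq c n u) (hc : c * c = 1) :
    Climbing n u fun i => c * u i 0 + descent u i := by
  intro i hi
  have h1 := h.mono i hi
  simp only [descent_succ]
  have h2 := le_max_left (u i 1 - u (i + 1) 1) 0
  have h3 := le_max_right (u i 1 - u (i + 1) 1) 0
  refine ⟨by linarith, ?_, by linarith, ?_⟩
  · refine le_trans ?_ (show c * u (i + 1) 0 - c * u i 0 ≤ _ by linarith)
    refine abs_le_of_sq_le_sq ?_ (by linarith)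
    nlinarith [congrArg (· * (u (i + 1) 0 - u i 0) ^ 2) hc]
  · rcases h.rect i hi with h4 | h4
    · rcases le_total (u i 1) (u (i + 1) 1) with h5 | h5
      · right
        rw [max_eq_right (by linarith), h4, add_zero]
      · left
        linarith
    · left
      linarith

/-- The part of a tame path on a vertical line does not go below both of its ends. -/
theorem min_le_snd (h : TameSeq c n u) (hc : c * c = 1) {i k j : ℕ} (hik : i ≤ k) (hkj : k ≤ j)
    (hj : j ≤ n) (hx : c * u i 0 = c * u j 0) : min (u i 1) (u j 1) ≤ u k 1 := by
  by_contra! hlt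
  obtain ⟨hi, hj'⟩ := lt_min_iff.1 hlt
  have hconst : ∀ p, i ≤ p → p ≤ j → u p 0 = u i 0 := by
    intro p hp hpj
    have h1 := h.mono_of_le hp (by omega)
    have h2 := h.mono_of_le hpj hj
    have h3 : c * u p 0 = c * u i 0 := by linarith
    linear_combination c * h3 - (u p 0 - u i 0) * hc
  obtain ⟨a, hia, hak, ha, ha'⟩ : ∃ a, i ≤ a ∧ a < k ∧ u k 1 < u a 1 ∧ u (a + 1) 1 ≤ u k 1 := by
    let Q : ℕ → Prop := fun a => u k 1 < u a 1
    have hspec : Q (Nat.findGreatest Q k) := Nat.findGreatest_spec (P := Q) hik hi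
    have hlt : Nat.findGreatest Q k < k := by
      refine lt_of_le_of_ne (Nat.findGreatest_le (P := Q) k) fun heq => ?_
      rw [heq] at hspec
      exact lt_irrefl _ hspec
    exact ⟨_, Nat.le_findGreatest (P := Q) hik hi, hlt, hspec,
      not_lt.1 (Nat.findGreatest_is_greatest (P := Q) (Nat.lt_succ_self _) hlt)⟩
  obtain ⟨b, hkb, hbj, hb, hb'⟩ : ∃ b, k ≤ b ∧ b < j ∧ u b 1 ≤ u k 1 ∧ u k 1 < u (b + 1) 1 := by
    have hex : ∃ b, k ≤ b ∧ u k 1 < u b 1 := ⟨j, hkj, hj'⟩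
    obtain ⟨b, ⟨hkb, hb⟩, hmin⟩ : ∃ b, (k ≤ b ∧ u k 1 < u b 1) ∧
        ∀ p < b, ¬(k ≤ p ∧ u k 1 < u p 1) :=
      ⟨Nat.find hex, Nat.find_spec hex, fun p hp => Nat.find_min hex hp⟩
    have hne : k ≠ b := fun heq => by rw [heq] at hb; exact lt_irrefl _ hb
    obtain ⟨b, rfl⟩ : ∃ p, b = p + 1 := ⟨b - 1, by omega⟩
    refine ⟨b, by omega, ?_, ?_, hb⟩
    · by_contra! hjb
      exact hmin j (by omega) ⟨hkj, hj'⟩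
    · by_contra! hcon
      exact hmin b (by omega) ⟨by omega, hcon⟩
  -- a point that the path passes on its way down and again on its way up
  obtain ⟨q, hq0, hq1⟩ : ∃ q : Plane, q 0 = u i 0 ∧ q 1 = min (u a 1) (u (b + 1) 1) :=
    ⟨pt (u i 0) (min (u a 1) (u (b + 1) 1)), rfl, rfl⟩
  have hqk : u k 1 < q 1 := hq1 ▸ lt_min ha hb'
  have hqa : q ∈ segment ℝ (u a) (u (a + 1)) := by
    rw [segment_symm]
    refine mem_segment_of_vertical ?_ ?_ (by linarith) (hq1 ▸ min_le_left _ _)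
    · rw [hconst a hia (by omega), hconst (a + 1) (by omega) (by omega)]
    · rw [hq0, hconst (a + 1) (by omega) (by omega)]
  have hqb : q ∈ segment ℝ (u b) (u (b + 1)) := by
    refine mem_segment_of_vertical ?_ ?_ (by linarith) (hq1 ▸ min_le_right _ _)
    · rw [hconst b (by omega) (by omega), hconst (b + 1) (by omega) (by omega)]
    · rw [hq0, hconst b (by omega) (by omega)]
  have hchord : segment ℝ q q ⊆ belowRegion (pathSet n u) := by
    rw [segment_same, Set.singleton_subset_iff]
    exact mem_belowRegion_of_mem (mem_pathSet.2 ⟨b, by omega, hqb⟩)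
  have ht := h.tame a b q q (by omega) (by omega) hqa hqb rfl hchord
  have h1 := arcPos_add_norm u hqa
  have h2 : ∑ k ∈ Finset.range (a + 1), ‖u (k + 1) - u k‖ ≤
      ∑ k ∈ Finset.range b, ‖u (k + 1) - u k‖ :=
    Finset.sum_le_sum_of_subset_of_nonneg (Finset.range_mono (by omega))
      fun _ _ _ => norm_nonneg _
  have h3 : 0 < ‖q - u b‖ := by
    rw [norm_sub_pos_iff]
    rintro rfl
    linarith
  rw [sub_self, norm_zero, mul_zero, arcPos] at ht
  linarith [norm_nonneg (u (a + 1) - q)]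

end TameSeq

namespace TameSeq

variable {c : ℝ} {n : ℕ} {u : ℕ → Plane}

theorem snd_eq_of_mem_pathSet (h : TameSeq c n u) {i : ℕ} (hi : i < n) {q : Plane}
    (hq : q ∈ pathSet n u) (h1 : c * u i 0 < c * q 0) (h2 : c * q 0 < c * u (i + 1) 0) :
    q 1 = u i 1 := by
  obtain ⟨j, hj, hqj⟩ := mem_pathSet.1 hq
  rcases lt_trichotomy j i with hji | rfl | hji
  · have h3 := h.mono_of_le (show j + 1 ≤ i by omega) hi.le
    have h4 := h.mono j hj
    have := le_mul_fst_of_mem_segment hqj (c := -c) (x := -(c * u i 0)) (by linarith) (by linarith)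
    linarith
  · have h3 : u j 1 = u (j + 1) 1 :=
      (h.rect j hi).resolve_left fun h0 => by rw [h0] at h1; linarith
    exact le_antisymm (snd_le_of_mem_segment hqj le_rfl h3.ge)
      (le_snd_of_mem_segment hqj le_rfl h3.le)
  · have h3 := h.mono_of_le (show i + 1 ≤ j by omega) hj.le
    have h4 := h.mono j hj
    have := le_mul_fst_of_mem_segment hqj h3 (h3.trans h4)
    linarith

/-- A segment below the path is below each horizontal edge of the path that it spans. -/
theorem line_le_of_segment_subset (h : TameSeq c n u) {a b : Plane}
    (hsub : segment ℝ a b ⊆ belowRegion (pathSet n u)) {i : ℕ} (hi : i < n)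
    (ha : c * a 0 ≤ c * u i 0) (hi' : c * u i 0 < c * u (i + 1) 0)
    (hb : c * u (i + 1) 0 ≤ c * b 0) {t : ℝ} (ht : t ∈ Set.Icc (c * u i 0) (c * u (i + 1) 0)) :
    a 1 + (b 1 - a 1) / (c * b 0 - c * a 0) * (t - c * a 0) ≤ u i 1 := by
  have hw : 0 < c * b 0 - c * a 0 := by linarith
  rw [← closure_Ioo hi'.ne] at ht
  have hclosed : IsClosed {t : ℝ | a 1 + (b 1 - a 1) / (c * b 0 - c * a 0) * (t - c * a 0) ≤
      u i 1} := isClosed_le (by fun_prop) continuous_const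
  refine hclosed.closure_subset_iff.2 ?_ ht
  rintro t ⟨ht1, ht2⟩
  obtain ⟨l, hl⟩ : ∃ l, l = (t - c * a 0) / (c * b 0 - c * a 0) := ⟨_, rfl⟩
  have hl0 : 0 ≤ l := hl ▸ div_nonneg (by linarith) hw.le
  have hl1 : l ≤ 1 := by
    rw [hl, div_le_one hw]
    linarith
  have hlt : l * (c * b 0 - c * a 0) = t - c * a 0 := by
    rw [hl, div_mul_cancel₀ _ hw.ne']
  obtain ⟨⟨q, hq, hq0, hq1⟩, -⟩ := hsub ⟨1 - l, l, by linarith, hl0, by ring, rfl⟩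
  simp only [PiLp.add_apply, PiLp.smul_apply, smul_eq_mul] at hq0 hq1
  have hcq : c * q 0 = t := by
    rw [hq0]
    linear_combination hlt
  rw [h.snd_eq_of_mem_pathSet hi hq (by rwa [hcq]) (by rwa [hcq])] at hq1
  refine le_trans (le_of_eq ?_) hq1
  rw [div_mul_eq_mul_div, mul_div_assoc, ← hl]
  ring

/-- If the segment between two vertices is below the path and ascends with slope at least `s`, then
the path between them stays above the ray of slope `s` from the lower vertex. -/
theorem le_snd_of_segment_subset (h : TameSeq c n u) (hc : c * c = 1) {i k j : ℕ} (hik : i ≤ k)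
    (hkj : k ≤ j) (hj : j ≤ n) (hsub : segment ℝ (u i) (u j) ⊆ belowRegion (pathSet n u)) {s : ℝ}
    (hslope : s * (c * u j 0 - c * u i 0) ≤ u j 1 - u i 1) :
    u i 1 + s * (c * u k 0 - c * u i 0) ≤ u k 1 := by
  have hmk := h.mono_of_le hik (by omega)
  have hmj := h.mono_of_le hkj hj
  rcases (hmk.trans hmj).eq_or_lt with hw | hw
  · have h1 : c * u k 0 = c * u i 0 := by linarith
    have h2 := h.min_le_snd hc hik hkj hj hw
    rw [hw, sub_self, mul_zero] at hslope
    rw [min_eq_left (by linarith)] at h2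
    rwa [h1, sub_self, mul_zero, add_zero]
  obtain ⟨β, hβ⟩ : ∃ β, β = (u j 1 - u i 1) / (c * u j 0 - c * u i 0) := ⟨_, rfl⟩
  have hw' : 0 < c * u j 0 - c * u i 0 := by linarith
  have hsβ : s ≤ β := by rwa [hβ, le_div_iff₀ hw']
  have hβw : β * (c * u j 0 - c * u i 0) = u j 1 - u i 1 := by
    rw [hβ, div_mul_cancel₀ _ hw'.ne']
  suffices u i 1 + β * (c * u k 0 - c * u i 0) ≤ u k 1 by
    have := mul_le_mul_of_nonneg_right hsβ (sub_nonneg.2 hmk)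
    linarith
  obtain ⟨k₁, hik₁, hk₁k, hk₁, hy₁⟩ : ∃ k₁, i ≤ k₁ ∧ k₁ ≤ k ∧ c * u k₁ 0 = c * u k 0 ∧
      u i 1 + β * (c * u k 0 - c * u i 0) ≤ u k₁ 1 := by
    have hex : ∃ p, i ≤ p ∧ c * u p 0 = c * u k 0 := ⟨k, hik, rfl⟩
    obtain ⟨p, ⟨hip, hp⟩, hpk, hmin⟩ : ∃ p, (i ≤ p ∧ c * u p 0 = c * u k 0) ∧ p ≤ k ∧
        ∀ r < p, ¬(i ≤ r ∧ c * u r 0 = c * u k 0) :=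
      ⟨Nat.find hex, Nat.find_spec hex, Nat.find_min' hex ⟨hik, rfl⟩,
        fun r hr => Nat.find_min hex hr⟩
    refine ⟨p, hip, hpk, hp, ?_⟩
    rcases hip.eq_or_lt with rfl | hip
    · simp [hp]
    obtain ⟨p, rfl⟩ : ∃ r, p = r + 1 := ⟨p - 1, by omega⟩
    have hlt : c * u p 0 < c * u (p + 1) 0 :=
      lt_of_le_of_ne (h.mono p (by omega)) fun heq => hmin p (by omega) ⟨by omega, by linarith⟩
    have hflat : u p 1 = u (p + 1) 1 :=
      (h.rect p (by omega)).resolve_left fun h0 => by rw [h0] at hlt; linarith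
    rw [← hflat, hβ]
    exact h.line_le_of_segment_subset hsub (by omega) (h.mono_of_le (by omega) (by omega)) hlt
      (by linarith) ⟨by linarith, by linarith⟩
  obtain ⟨k₂, hkk₂, hk₂j, hk₂, hy₂⟩ : ∃ k₂, k ≤ k₂ ∧ k₂ ≤ j ∧ c * u k₂ 0 = c * u k 0 ∧
      u i 1 + β * (c * u k 0 - c * u i 0) ≤ u k₂ 1 := by
    let Q : ℕ → Prop := fun p => c * u p 0 = c * u k 0
    obtain ⟨p, hkp, hpj, hp, hmax⟩ : ∃ p, k ≤ p ∧ p ≤ j ∧ Q p ∧ ∀ r, p < r → r ≤ j → ¬Q r :=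
      ⟨Nat.findGreatest Q j, Nat.le_findGreatest (P := Q) hkj rfl, Nat.findGreatest_le (P := Q) j,
        Nat.findGreatest_spec (P := Q) hkj rfl,
        fun r hr hrj => Nat.findGreatest_is_greatest (P := Q) hr hrj⟩
    refine ⟨p, hkp, hpj, hp, ?_⟩
    change c * u p 0 = c * u k 0 at hp
    rcases hpj.eq_or_lt with rfl | hpj
    · rw [← hp, hβw]
      linarith
    have hlt : c * u p 0 < c * u (p + 1) 0 :=
      lt_of_le_of_ne (h.mono p (by omega)) fun heq =>
        hmax (p + 1) (by omega) (by omega) (by change c * u (p + 1) 0 = c * u k 0; linarith)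
    rw [hβ]
    exact h.line_le_of_segment_subset hsub (by omega) (h.mono_of_le (by omega) (by omega)) hlt
      (h.mono_of_le (by omega) hj) ⟨by linarith, by linarith⟩
  exact (le_min hy₁ hy₂).trans (h.min_le_snd hc hk₁k hkk₂ (by omega) (by linarith))

/-- The directional spanner for those pairs of vertices whose lower one comes first. -/
theorem exists_spanner_ascending (h : TameSeq c n u) (hc : c * c = 1) {s : ℝ} (hs : 0 < s) :
    ∃ Ex : Finset (Plane × Plane), gweight Ex ≤ 272 * (s * (c * u n 0 - c * u 0 0)) ∧
      ∀ i j, i ≤ j → j ≤ n → segment ℝ (u i) (u j) ⊆ belowRegion (pathSet n u) →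
        s * (c * u j 0 - c * u i 0) ≤ u j 1 - u i 1 →
        Conn (pathSet n u ∪ segUnion Ex) (u i) (u j)
          (u j 1 - u i 1 + 2448 * (s⁻¹ * (c * u j 0 - c * u i 0))) := by
  have hprogress : ∀ i j, i ≤ j → j ≤ n → (∀ p, i ≤ p → p ≤ j → u i 1 ≤ u p 1) →
      (c * u j 0 + descent u j) - (c * u i 0 + descent u i) ≤ 3 * (c * u j 0 - c * u i 0) := by
    intro i j hij hj hy
    linarith [h.descent_le hc hij hj hy]
  have hcl := h.climbing hc
  have hs3 : 0 < s / 3 := by positivity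
  obtain ⟨Ex, hw, hconn, -⟩ := exists_augment_pieces (σ := s / 3) (M := n)
    (fun N _ => augmentable hs3 N) n le_rfl u (fun i => c * u i 0 + descent u i)
    (fun i => s * (c * u i 0)) (pathSet n u) hcl
    (fun i hi z hz => mem_pathSet.2 ⟨i, hi, hz⟩)
    (fun i hi => mul_le_mul_of_nonneg_left (h.mono i hi) hs.le) (fun j r hjr hr hab => by
      have h1 := hprogress j r hjr hr fun p hp hpr => by
        have h2 := hab p hp hpr
        have h3 := mul_nonneg hs3.le (sub_nonneg.2 (hcl.mono hp (by omega)))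
        linarith
      have := mul_le_mul_of_nonneg_left h1 hs3.le
      linarith)
  refine ⟨Ex, by linarith, fun i j hij hj hsub hslope => ?_⟩
  have hray : ∀ k, i ≤ k → k ≤ j → u i 1 + s * (c * u k 0 - c * u i 0) ≤ u k 1 :=
    fun k hik hkj => h.le_snd_of_segment_subset hc hik hkj hj hsub hslope
  have hprog : ∀ k, i ≤ k → k ≤ j →
      (c * u k 0 + descent u k) - (c * u i 0 + descent u i) ≤ 3 * (c * u k 0 - c * u i 0) :=
    fun k hik hkj => hprogress i k hik (by omega) fun p hip hpk => by
      have h1 := hray p hip (by omega)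
      have h2 := mul_nonneg hs.le (sub_nonneg.2 (h.mono_of_le hip (by omega)))
      linarith
  refine (hconn i j hij hj fun k hik hkj => ?_).mono subset_rfl ?_
  · have h1 := mul_le_mul_of_nonneg_left (hprog k hik hkj) hs3.le
    have h2 := hray k hik hkj
    linarith
  · have h1 := mul_le_mul_of_nonneg_left (hprog j hij le_rfl) (inv_pos.2 hs).le
    rw [inv_div, div_eq_mul_inv]
    linarith

end TameSeq

theorem hper_eq {n : ℕ} {u : ℕ → Plane} (h : ∀ i < n, u i 0 ≤ u (i + 1) 0) :
    hper n u = u n 0 - u 0 0 := by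
  rw [hper, ← Finset.sum_range_sub fun i => u i 0]
  refine Finset.sum_congr rfl fun i hi => abs_of_nonneg ?_
  exact sub_nonneg.2 (h i (Finset.mem_range.1 hi))

-- **Statement 18.** (Directional spanners for tame paths.) There is an absolute constant
-- `C > 0` such that for every `ε ∈ (0,1]`, every tame path `L`, and every finite
-- `S ⊂ L`, there is a geometric graph comprised of the edges of `L` and additional
-- segments of total weight at most `C·ε^{-1/2}·hper(L)` containing, for all `a, b ∈ S`
-- such that `ab` lies below `L` and `|x(a) − x(b)| ≤ ε^{1/2}·|y(a) − y(b)|`, an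
-- `ab`-path of weight at most `(1 + C·ε)·‖a − b‖`.
theorem directional_spanner_tame_path :
    ∃ C : ℝ, 0 < C ∧
      ∀ ε : ℝ, 0 < ε → ε ≤ 1 →
      ∀ (n : ℕ) (u : ℕ → Plane), IsTamePath n u →
      ∀ S : Finset Plane, ↑S ⊆ pathSet n u →
        ∃ Ex : Finset (Plane × Plane),
          gweight Ex ≤ C * (Real.sqrt ε)⁻¹ * hper n u ∧
          ∀ a ∈ S, ∀ b ∈ S,
            segment ℝ a b ⊆ belowRegion (pathSet n u) →
            |a 0 - b 0| ≤ Real.sqrt ε * |a 1 - b 1| →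
            HasPath (pathEdges n u ∪ Ex) a b ((1 + C * ε) * ‖a - b‖) := by

  refine ⟨2448, by norm_num, fun ε hε _ n u hu S hS => ?_⟩
  have hr : 0 < Real.sqrt ε := Real.sqrt_pos.2 hε
  have hs : 0 < (Real.sqrt ε)⁻¹ := inv_pos.2 hr
  obtain ⟨m, v, hv, hset, h0, hm, hvert⟩ := hu.tameSeq.exists_refinement S hS
  obtain ⟨E₁, hw₁, hc₁⟩ := hv.exists_spanner_ascending (by norm_num) hs
  obtain ⟨E₂, hw₂, hc₂⟩ := hv.reverse.exists_spanner_ascending (by norm_num) hs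
  simp only [Nat.sub_self, Nat.sub_zero, pathSet_reverse] at hw₂ hc₂
  rw [hset] at hc₁ hc₂
  have hsub₁ : pathSet n u ∪ segUnion E₁ ⊆ segUnion (pathEdges n u ∪ (E₁ ∪ E₂)) := by
    rw [segUnion_union, segUnion_pathEdges]
    exact Set.union_subset_union_right _ (segUnion_mono Finset.subset_union_left)
  have hsub₂ : pathSet n u ∪ segUnion E₂ ⊆ segUnion (pathEdges n u ∪ (E₁ ∪ E₂)) := by
    rw [segUnion_union, segUnion_pathEdges]
    exact Set.union_subset_union_right _ (segUnion_mono Finset.subset_union_right)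
  have hlow : ∀ a ∈ S, ∀ b ∈ S, a 1 ≤ b 1 → segment ℝ a b ⊆ belowRegion (pathSet n u) →
      |a 0 - b 0| ≤ Real.sqrt ε * |a 1 - b 1| →
      Conn (segUnion (pathEdges n u ∪ (E₁ ∪ E₂))) a b ((1 + 2448 * ε) * ‖a - b‖) := by
    intro a ha b hb hab hsub hsteep
    rw [abs_sub_comm (a 1), abs_of_nonneg (sub_nonneg.2 hab)] at hsteep
    obtain ⟨i, hi, rfl⟩ := hvert a ha
    obtain ⟨j, hj, rfl⟩ := hvert b hb
    have hslope : ∀ x ≤ |v i 0 - v j 0|, (Real.sqrt ε)⁻¹ * x ≤ v j 1 - v i 1 := by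
      intro x hx
      rw [inv_mul_le_iff₀ hr]
      exact hx.trans hsteep
    have hcost : ∀ x ≤ |v i 0 - v j 0|, v j 1 - v i 1 + 2448 * ((Real.sqrt ε)⁻¹⁻¹ * x) ≤
        (1 + 2448 * ε) * ‖v i - v j‖ := by
      intro x hx
      rw [inv_inv]
      have h1 : v j 1 - v i 1 ≤ ‖v i - v j‖ := by
        have := Plane.abs_snd_le_norm (v i - v j)
        rw [PiLp.sub_apply, abs_sub_comm] at this
        exact (le_abs_self _).trans this
      have h2 := mul_le_mul_of_nonneg_left (hx.trans hsteep) hr.le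
      rw [← mul_assoc, Real.mul_self_sqrt hε.le] at h2
      have h3 := mul_le_mul_of_nonneg_left h1 hε.le
      linarith
    rcases le_total i j with hij | hij
    · have hx : 1 * v j 0 - 1 * v i 0 ≤ |v i 0 - v j 0| := by
        rw [abs_sub_comm, one_mul, one_mul]
        exact le_abs_self _
      exact (hc₁ i j hij hj hsub (hslope _ hx)).mono hsub₁ (hcost _ hx)
    · have hx : -1 * v j 0 - -1 * v i 0 ≤ |v i 0 - v j 0| := by
        have := le_abs_self (v i 0 - v j 0)
        linarith
      have := hc₂ (m - i) (m - j) (by omega) (by omega)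
      rw [Nat.sub_sub_self hi, Nat.sub_sub_self hj] at this
      exact (this hsub (hslope _ hx)).mono hsub₂ (hcost _ hx)
  refine ⟨E₁ ∪ E₂, ?_, fun a ha b hb hsub hsteep => Conn.hasPath ?_⟩
  · rw [hper_eq hu.2.1, ← h0, ← hm]
    have h1 := gweight_union_le E₁ E₂
    have h2 : 0 ≤ (Real.sqrt ε)⁻¹ * (v m 0 - v 0 0) := by
      have := hv.mono_of_le (Nat.zero_le m) le_rfl
      exact mul_nonneg hs.le (by linarith)
    linarith
  · rcases le_total (a 1) (b 1) with hab | hab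
    · exact hlow a ha b hb hab hsub hsteep
    · rw [norm_sub_rev]
      refine (hlow b hb a ha hab (by rwa [segment_symm]) ?_).symm
      rwa [abs_sub_comm, abs_sub_comm (b 1)]

end
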